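/- Let g_{S³} : ℝ³ → Matrix (Fin 3) (Fin 3) ℝ be given at p = (x,y,z) by the symmetric matrix F·[[y²+z²+1, −xy, −xz], [−xy, x²+z²+1, −yz], [−xz, −yz, x²+y²+1]] with F = (x²+y²+z²+1)^{−2}, with Levi-Civita Christoffel symbols Γ(p) i j k := (1/2)·Σ_l (g_{S³}(p)⁻¹) k l · (∂_i (g_{S³})_{jl} + ∂_j (g_{S³})_{il} − ∂_l (g_{S³})_{ij})(p). Let θ : ℝ³ → (Fin 3 → ℝ) have components θ₁ = −y, θ₂ = x, θ₃ = 1 (the contact form dz + x dy − y dx). Then the scalar part of the contact Riemannian curl vanishes identically: for every p ∈ ℝ³, Σ_{i,j} (g_{S³}(p)⁻¹) i j · (∂_i θ_j(p) − Σ_k Π(Γ(p)) i j k · θ_k(p)) = 0, where Π(c) i j k := c i j k − (1/4)·((if i = k then Σ_l c j l l else 0) + (if j = k then Σ_l c i l l else 0)). -/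

import Mathlib

/-- The standard basis vectors of `ℝ³ = ℝ × ℝ × ℝ`. -/
def bv3 : Fin 3 → ℝ × ℝ × ℝ := ![(1, 0, 0), (0, 1, 0), (0, 0, 1)]

/-- The partial derivative `∂_i f (p)` on `ℝ³`. -/
noncomputable def pd3 (i : Fin 3) (f : ℝ × ℝ × ℝ → ℝ) (p : ℝ × ℝ × ℝ) : ℝ :=
  fderiv ℝ f p (bv3 i)

/-- The round metric of `S³` in the affine coordinates `(x, y, z)`:
`g = F·[[y²+z²+1, −xy, −xz], [−xy, x²+z²+1, −yz], [−xz, −yz, x²+y²+1]]`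
with `F = (x²+y²+z²+1)^{−2}`. -/
noncomputable def gS3 (p : ℝ × ℝ × ℝ) : Matrix (Fin 3) (Fin 3) ℝ :=
  ((p.1 ^ 2 + p.2.1 ^ 2 + p.2.2 ^ 2 + 1) ^ 2)⁻¹ •
    !![p.2.1 ^ 2 + p.2.2 ^ 2 + 1, -(p.1 * p.2.1), -(p.1 * p.2.2);
       -(p.1 * p.2.1), p.1 ^ 2 + p.2.2 ^ 2 + 1, -(p.2.1 * p.2.2);
       -(p.1 * p.2.2), -(p.2.1 * p.2.2), p.1 ^ 2 + p.2.1 ^ 2 + 1]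

/-- The Levi-Civita Christoffel symbols of a metric `g` on `ℝ³`:
`Γ(p) i j k = (1/2)·Σ_l (g(p)⁻¹) k l · (∂_i g_{jl} + ∂_j g_{il} − ∂_l g_{ij})(p)`. -/
noncomputable def christoffel3 (g : ℝ × ℝ × ℝ → Matrix (Fin 3) (Fin 3) ℝ)
    (p : ℝ × ℝ × ℝ) (i j k : Fin 3) : ℝ :=
  (1 / 2) * ∑ l, (g p)⁻¹ k l *
    (pd3 i (fun q => g q j l) p + pd3 j (fun q => g q i l) p - pd3 l (fun q => g q i j) p)

/-- The projective symbol, for `n = 3` (so `n + 1 = 4`):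
`Π(c) i j k = c i j k − (1/4)·((if i = k then Σ_l c j l l else 0) + (if j = k then Σ_l c i l l else 0))`. -/
noncomputable def projSymbol3 (c : Fin 3 → Fin 3 → Fin 3 → ℝ) (i j k : Fin 3) : ℝ :=
  c i j k - (1 / 4) *
    ((if i = k then ∑ l, c j l l else 0) + (if j = k then ∑ l, c i l l else 0))


/-- The components of the contact form `dz + x dy − y dx`:
`θ₁ = −y`, `θ₂ = x`, `θ₃ = 1`. -/
noncomputable def θ3 : Fin 3 → ℝ × ℝ × ℝ → ℝ :=
  ![fun p => -p.2.1, fun p => p.1, fun _ => 1]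

noncomputable def cX (a : Fin 3) : ℝ × ℝ × ℝ →L[ℝ] ℝ :=
  ![ContinuousLinearMap.fst ℝ ℝ (ℝ × ℝ),
    (ContinuousLinearMap.fst ℝ ℝ ℝ).comp (ContinuousLinearMap.snd ℝ ℝ (ℝ × ℝ)),
    (ContinuousLinearMap.snd ℝ ℝ ℝ).comp (ContinuousLinearMap.snd ℝ ℝ (ℝ × ℝ))] a

noncomputable def cN (p : ℝ × ℝ × ℝ) : ℝ := p.1 ^ 2 + p.2.1 ^ 2 + p.2.2 ^ 2 + 1

def dl (a b : Fin 3) : ℝ := if a = b then 1 else 0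

lemma cN_pos (p : ℝ × ℝ × ℝ) : 0 < cN p := by unfold cN; positivity

lemma cN_eq (p : ℝ × ℝ × ℝ) : cN p = cX 0 p * cX 0 p + cX 1 p * cX 1 p + cX 2 p * cX 2 p + 1 := by
  simp [cN, cX]; ring

lemma gS3_apply (p : ℝ × ℝ × ℝ) (a b : Fin 3) :
    gS3 p a b = (cN p * dl a b - cX a p * cX b p) * ((cN p) ^ 2)⁻¹ := by
  fin_cases a <;> fin_cases b <;> simp [gS3, cN, cX, dl] <;> ring

lemma cX_bv (a i : Fin 3) : cX a (bv3 i) = dl i a := by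
  fin_cases a <;> fin_cases i <;> simp [cX, bv3, dl]

lemma pd3_gS3 (p : ℝ × ℝ × ℝ) (i a b : Fin 3) :
    pd3 i (fun q => gS3 q a b) p =
      (-2 * cX i p * dl a b * cN p - (dl i a * cX b p + cX a p * dl i b) * cN p
        + 4 * cX i p * cX a p * cX b p) / (cN p) ^ 3 := by
  have hX : ∀ a, HasFDerivAt (fun q => cX a q) (cX a) p := fun a => (cX a).hasFDerivAt
  have hNe := (cN_pos p).ne'
  have hN : HasFDerivAt cN _ p := (((((hX 0).mul (hX 0)).add ((hX 1).mul (hX 1))).add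
    ((hX 2).mul (hX 2))).add_const 1).congr_of_eventuallyEq
      (Filter.Eventually.of_forall cN_eq)
  have hinv := (hasDerivAt_inv (pow_ne_zero 2 hNe)).comp_hasFDerivAt p (hN.pow 2)
  have h := ((hN.mul_const (dl a b)).sub ((hX a).mul (hX b))).mul hinv
  have h2 := h.congr_of_eventuallyEq (f₁ := fun q => gS3 q a b)
      (Filter.Eventually.of_forall fun q => gS3_apply q a b)
  have hs : cX 0 p * dl i 0 + cX 1 p * dl i 1 + cX 2 p * dl i 2 = cX i p := by
    fin_cases i <;> simp [dl]
  rw [pd3, h2.fderiv]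
  simp [cX_bv]
  rw [← hs]
  field_simp
  ring

lemma gS3_inv (p : ℝ × ℝ × ℝ) :
    (gS3 p)⁻¹ = Matrix.of fun a b => cN p * (dl a b + cX a p * cX b p) := by
  apply Matrix.inv_eq_right_inv
  have hNe := (cN_pos p).ne'
  have e := cN_eq p
  ext a b
  simp only [Matrix.mul_apply, Fin.sum_univ_three, gS3_apply, Matrix.of_apply]
  generalize cN p = N at *
  have : (1 : Matrix (Fin 3) (Fin 3) ℝ) a b = dl a b := by simp [dl, Matrix.one_apply]
  rw [this]
  field_simp
  subst e
  fin_cases a <;> fin_cases b <;> simp [dl] <;> ring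

lemma chr (p : ℝ × ℝ × ℝ) (i j k : Fin 3) :
    christoffel3 gS3 p i j k = -(dl i k * cX j p + dl j k * cX i p) / cN p := by
  have hNe := (cN_pos p).ne'
  have e := cN_eq p
  simp only [christoffel3, pd3_gS3, gS3_inv, Fin.sum_univ_three, Matrix.of_apply]
  generalize cN p = N at *
  field_simp
  subst e
  fin_cases i <;> fin_cases j <;> fin_cases k <;> simp [dl] <;> ring

lemma proj_zero (p : ℝ × ℝ × ℝ) (i j k : Fin 3) :
    projSymbol3 (christoffel3 gS3 p) i j k = 0 := by
  simp only [projSymbol3, chr, Fin.sum_univ_three]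
  fin_cases i <;> fin_cases j <;> fin_cases k <;> simp [dl] <;> ring

lemma pd_θ (p : ℝ × ℝ × ℝ) (i j : Fin 3) :
    pd3 i (θ3 j) p = dl i 0 * dl j 1 - dl i 1 * dl j 0 := by
  have h0 : θ3 0 = fun q => (-(cX 1)) q := by ext q; simp [θ3, cX]
  have h1 : θ3 1 = fun q => (cX 0) q := by ext q; simp [θ3, cX]
  have h2 : θ3 2 = fun q => (1 : ℝ) := by ext q; simp [θ3]
  have c0 : pd3 i (θ3 0) p = - dl i 1 := by
    rw [h0, pd3, ContinuousLinearMap.fderiv]; simp [cX_bv]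
  have c1 : pd3 i (θ3 1) p = dl i 0 := by
    rw [h1, pd3, ContinuousLinearMap.fderiv]; simp [cX_bv]
  have c2 : pd3 i (θ3 2) p = 0 := by
    rw [h2, pd3]; simp
  fin_cases j
  · simpa [dl] using c0
  · simpa [dl] using c1
  · simpa [dl] using c2

/-- **Proposition 6.1.1(i).** For the round metric `g_{S³}` and the contact form
`dz + x dy − y dx`, the scalar part of the contact Riemannian curl vanishes
identically. -/
theorem curl_gS3_eq_zero :
    ∀ p : ℝ × ℝ × ℝ,
      ∑ i, ∑ j, (gS3 p)⁻¹ i j *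
        (pd3 i (θ3 j) p - ∑ k, projSymbol3 (christoffel3 gS3 p) i j k * θ3 k p) = 0 := by
  intro p
  simp only [proj_zero, pd_θ, gS3_inv, Fin.sum_univ_three, Matrix.of_apply]
  simp [dl]
  ring
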